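/- (Triviality of the conservation law ω₅: an off-shell identity.) For all smooth functions u, p : ℝ³ → ℝ (no equations imposed), set X₅ = 2·u_xx·p_t − 2·u_xt·p_x − p_yt, Y₅ = 2·u_xy·p_t − u_yt·p_x − u_y·p_xt − u_xt·p_y + u_x·p_yt − p_tt, and F_p = p_yy − u_y·p_xx + u_xy·p_x + u_x·p_xy − u_xx·p_y − p_xt. Then the identity ∂_x(Y₅) − ∂_y(X₅) = ∂_t(F_p) holds at every point of ℝ³. (Hence the generating section of ω₅ vanishes and ω₅ is a trivial conservation law on J^∞, although the associated covering is nontrivial.) -/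

import Mathlib

noncomputable section

/-- Partial derivative with respect to the first coordinate `t`. -/
def Dt (f : ℝ → ℝ → ℝ → ℝ) : ℝ → ℝ → ℝ → ℝ := fun t x y => deriv (fun s => f s x y) t

/-- Partial derivative with respect to the second coordinate `x`. -/
def Dx (f : ℝ → ℝ → ℝ → ℝ) : ℝ → ℝ → ℝ → ℝ := fun t x y => deriv (fun s => f t s y) x

/-- Partial derivative with respect to the third coordinate `y`. -/
def Dy (f : ℝ → ℝ → ℝ → ℝ) : ℝ → ℝ → ℝ → ℝ := fun t x y => deriv (fun s => f t x s) y

/-- `f` is a smooth function on `ℝ³` (given in curried form, coordinates `(t, x, y)`). -/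
def Smooth3 (f : ℝ → ℝ → ℝ → ℝ) : Prop :=
  ContDiff ℝ (⊤ : ℕ∞) (fun p : ℝ × ℝ × ℝ => f p.1 p.2.1 p.2.2)

/-- The Pavlov–Mikhalev equation `u_yy = u_xt − u_x·u_xy + u_y·u_xx`. -/
def PMu (u : ℝ → ℝ → ℝ → ℝ) : Prop :=
  ∀ t x y : ℝ, Dy (Dy u) t x y =
    Dt (Dx u) t x y - Dx u t x y * Dy (Dx u) t x y + Dy u t x y * Dx (Dx u) t x y

/-- The second equation of the two-component Pavlov–Mikhalev system:
`v_yy = v_xt − u_x·v_xy − 2·v_y·u_xx + 2·v_x·u_xy + u_y·v_xx`. -/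
def PMv (u v : ℝ → ℝ → ℝ → ℝ) : Prop :=
  ∀ t x y : ℝ, Dy (Dy v) t x y =
    Dt (Dx v) t x y - Dx u t x y * Dy (Dx v) t x y
      - 2 * Dy v t x y * Dx (Dx u) t x y + 2 * Dx v t x y * Dy (Dx u) t x y
      + Dy u t x y * Dx (Dx v) t x y

/-- First equation of the linearized system applied to `A = φ^u`:
`φ^u_yy = φ^u_xt + u_xx·φ^u_y + u_y·φ^u_xx − u_x·φ^u_xy − u_xy·φ^u_x`. -/
def LinU (u A : ℝ → ℝ → ℝ → ℝ) : Prop :=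
  ∀ t x y : ℝ, Dy (Dy A) t x y =
    Dt (Dx A) t x y + Dx (Dx u) t x y * Dy A t x y + Dy u t x y * Dx (Dx A) t x y
      - Dx u t x y * Dy (Dx A) t x y - Dy (Dx u) t x y * Dx A t x y

/-- Second equation of the linearized system applied to `(A, B) = (φ^u, φ^v)`. -/
def LinV (u v A B : ℝ → ℝ → ℝ → ℝ) : Prop :=
  ∀ t x y : ℝ, Dy (Dy B) t x y =
    2 * Dx v t x y * Dy (Dx A) t x y - Dy (Dx v) t x y * Dx A t x y
      + Dx (Dx v) t x y * Dy A t x y - 2 * Dy v t x y * Dx (Dx A) t x y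
      + Dt (Dx B) t x y + 2 * Dy (Dx u) t x y * Dx B t x y
      - 2 * Dx (Dx u) t x y * Dy B t x y + Dy u t x y * Dx (Dx B) t x y
      - Dx u t x y * Dy (Dx B) t x y

/-- `(A,B)` is a symmetry generating function of the Pavlov–Mikhalev system over `(u,v)`. -/
def IsSymmetry (u v A B : ℝ → ℝ → ℝ → ℝ) : Prop := LinU u A ∧ LinV u v A B

/-- First equation of the tangent system over a solution `(u,v)`:
`p_yy = u_y·p_xx − u_xy·p_x − u_x·p_xy + u_xx·p_y + p_xt`. -/
def TanP (u p : ℝ → ℝ → ℝ → ℝ) : Prop :=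
  ∀ t x y : ℝ, Dy (Dy p) t x y =
    Dy u t x y * Dx (Dx p) t x y - Dy (Dx u) t x y * Dx p t x y
      - Dx u t x y * Dy (Dx p) t x y + Dx (Dx u) t x y * Dy p t x y + Dt (Dx p) t x y

/-- Second equation of the tangent system over a solution `(u,v)`:
`q_yy = 2·v_x·p_xy + v_xx·p_y − v_xy·p_x − 2·v_y·p_xx + 2·u_xy·q_x + u_y·q_xx
  − u_x·q_xy − 2·u_xx·q_y + q_xt`. -/
def TanQ (u v p q : ℝ → ℝ → ℝ → ℝ) : Prop :=
  ∀ t x y : ℝ, Dy (Dy q) t x y =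
    2 * Dx v t x y * Dy (Dx p) t x y + Dx (Dx v) t x y * Dy p t x y
      - Dy (Dx v) t x y * Dx p t x y - 2 * Dy v t x y * Dx (Dx p) t x y
      + 2 * Dy (Dx u) t x y * Dx q t x y + Dy u t x y * Dx (Dx q) t x y
      - Dx u t x y * Dy (Dx q) t x y - 2 * Dx (Dx u) t x y * Dy q t x y
      + Dt (Dx q) t x y

/-- The uncurried form of a curried function on `ℝ³`. -/
def uncurry3 (f : ℝ → ℝ → ℝ → ℝ) : ℝ × ℝ × ℝ → ℝ := fun q => f q.1 q.2.1 q.2.2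

namespace Smooth3

variable {f : ℝ → ℝ → ℝ → ℝ}

theorem hasFDerivAt (hf : Smooth3 f) (q : ℝ × ℝ × ℝ) :
    HasFDerivAt (uncurry3 f) (fderiv ℝ (uncurry3 f) q) q :=
  (ContDiff.differentiable hf (by simp) q).hasFDerivAt

theorem hasDerivAt_fderiv_t (hf : Smooth3 f) (t x y : ℝ) :
    HasDerivAt (fun s => f s x y) (fderiv ℝ (uncurry3 f) (t, x, y) (1, 0, 0)) t := by
  have hline : HasDerivAt (fun s : ℝ => (s, x, y)) (1, 0, 0) t :=
    (hasDerivAt_id t).prodMk ((hasDerivAt_const t x).prodMk (hasDerivAt_const t y))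
  exact (hf.hasFDerivAt (t, x, y)).comp_hasDerivAt t hline

theorem hasDerivAt_fderiv_x (hf : Smooth3 f) (t x y : ℝ) :
    HasDerivAt (fun s => f t s y) (fderiv ℝ (uncurry3 f) (t, x, y) (0, 1, 0)) x := by
  have hline : HasDerivAt (fun s : ℝ => (t, s, y)) (0, 1, 0) x :=
    (hasDerivAt_const x t).prodMk ((hasDerivAt_id x).prodMk (hasDerivAt_const x y))
  exact (hf.hasFDerivAt (t, x, y)).comp_hasDerivAt x hline

theorem hasDerivAt_fderiv_y (hf : Smooth3 f) (t x y : ℝ) :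
    HasDerivAt (fun s => f t x s) (fderiv ℝ (uncurry3 f) (t, x, y) (0, 0, 1)) y := by
  have hline : HasDerivAt (fun s : ℝ => (t, x, s)) (0, 0, 1) y :=
    (hasDerivAt_const y t).prodMk ((hasDerivAt_const y x).prodMk (hasDerivAt_id y))
  exact (hf.hasFDerivAt (t, x, y)).comp_hasDerivAt y hline

theorem contDiff_fderiv_apply (hf : Smooth3 f) (v : ℝ × ℝ × ℝ) :
    ContDiff ℝ (⊤ : ℕ∞) fun q => fderiv ℝ (uncurry3 f) q v :=
  (ContDiff.fderiv_right (m := (⊤ : ℕ∞)) hf (by simp)).clm_apply contDiff_const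

/-- Iterated directional derivatives of a smooth function commute. -/
theorem fderiv_fderiv_comm (hf : Smooth3 f) (q v w : ℝ × ℝ × ℝ) :
    fderiv ℝ (fun r => fderiv ℝ (uncurry3 f) r v) q w =
      fderiv ℝ (fun r => fderiv ℝ (uncurry3 f) r w) q v := by
  have hd : DifferentiableAt ℝ (fderiv ℝ (uncurry3 f)) q :=
    (ContDiff.fderiv_right (m := 1) hf (by norm_cast)).differentiable (by simp) q
  have hsymm : IsSymmSndFDerivAt ℝ (uncurry3 f) q :=
    (ContDiff.contDiffAt hf).isSymmSndFDerivAt (by simp; norm_cast)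
  have key (a b : ℝ × ℝ × ℝ) : fderiv ℝ (fun r => fderiv ℝ (uncurry3 f) r a) q b =
      fderiv ℝ (fderiv ℝ (uncurry3 f)) q b a := by
    rw [fderiv_clm_apply hd (differentiableAt_const a)]
    simp
  rw [key, key, hsymm.eq]

theorem uncurry3_Dt (hf : Smooth3 f) :
    uncurry3 (Dt f) = fun q => fderiv ℝ (uncurry3 f) q (1, 0, 0) :=
  funext fun q => (hf.hasDerivAt_fderiv_t q.1 q.2.1 q.2.2).deriv

protected theorem Dt (hf : Smooth3 f) : Smooth3 (Dt f) := by
  change ContDiff ℝ _ (uncurry3 (Dt f))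
  rw [hf.uncurry3_Dt]
  exact hf.contDiff_fderiv_apply _

theorem hasDerivAt_Dt (hf : Smooth3 f) (t x y : ℝ) :
    HasDerivAt (fun s => f s x y) (Dt f t x y) t :=
  (hf.hasDerivAt_fderiv_t t x y).differentiableAt.hasDerivAt

theorem uncurry3_Dx (hf : Smooth3 f) :
    uncurry3 (Dx f) = fun q => fderiv ℝ (uncurry3 f) q (0, 1, 0) :=
  funext fun q => (hf.hasDerivAt_fderiv_x q.1 q.2.1 q.2.2).deriv

protected theorem Dx (hf : Smooth3 f) : Smooth3 (Dx f) := by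
  change ContDiff ℝ _ (uncurry3 (Dx f))
  rw [hf.uncurry3_Dx]
  exact hf.contDiff_fderiv_apply _

theorem hasDerivAt_Dx (hf : Smooth3 f) (t x y : ℝ) :
    HasDerivAt (fun s => f t s y) (Dx f t x y) x :=
  (hf.hasDerivAt_fderiv_x t x y).differentiableAt.hasDerivAt

theorem uncurry3_Dy (hf : Smooth3 f) :
    uncurry3 (Dy f) = fun q => fderiv ℝ (uncurry3 f) q (0, 0, 1) :=
  funext fun q => (hf.hasDerivAt_fderiv_y q.1 q.2.1 q.2.2).deriv

protected theorem Dy (hf : Smooth3 f) : Smooth3 (Dy f) := by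
  change ContDiff ℝ _ (uncurry3 (Dy f))
  rw [hf.uncurry3_Dy]
  exact hf.contDiff_fderiv_apply _

theorem hasDerivAt_Dy (hf : Smooth3 f) (t x y : ℝ) :
    HasDerivAt (fun s => f t x s) (Dy f t x y) y :=
  (hf.hasDerivAt_fderiv_y t x y).differentiableAt.hasDerivAt

theorem Dx_Dt_comm (hf : Smooth3 f) : Dx (Dt f) = Dt (Dx f) := by
  funext t x y
  have h₁ := (hf.Dt.hasDerivAt_fderiv_x t x y).deriv
  have h₂ := (hf.Dx.hasDerivAt_fderiv_t t x y).deriv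
  rw [hf.uncurry3_Dt] at h₁
  rw [hf.uncurry3_Dx] at h₂
  exact h₁.trans ((hf.fderiv_fderiv_comm _ _ _).trans h₂.symm)

theorem Dy_Dt_comm (hf : Smooth3 f) : Dy (Dt f) = Dt (Dy f) := by
  funext t x y
  have h₁ := (hf.Dt.hasDerivAt_fderiv_y t x y).deriv
  have h₂ := (hf.Dy.hasDerivAt_fderiv_t t x y).deriv
  rw [hf.uncurry3_Dt] at h₁
  rw [hf.uncurry3_Dy] at h₂
  exact h₁.trans ((hf.fderiv_fderiv_comm _ _ _).trans h₂.symm)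

theorem Dy_Dx_comm (hf : Smooth3 f) : Dy (Dx f) = Dx (Dy f) := by
  funext t x y
  have h₁ := (hf.Dx.hasDerivAt_fderiv_y t x y).deriv
  have h₂ := (hf.Dy.hasDerivAt_fderiv_x t x y).deriv
  rw [hf.uncurry3_Dx] at h₁
  rw [hf.uncurry3_Dy] at h₂
  exact h₁.trans ((hf.fderiv_fderiv_comm _ _ _).trans h₂.symm)

end Smooth3

theorem omega5_trivial (u p : ℝ → ℝ → ℝ → ℝ) (hu : Smooth3 u) (hp : Smooth3 p)
    (X₅ Y₅ Fp : ℝ → ℝ → ℝ → ℝ)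
    (hX : X₅ = fun t x y => 2 * Dx (Dx u) t x y * Dt p t x y
      - 2 * Dt (Dx u) t x y * Dx p t x y - Dt (Dy p) t x y)
    (hY : Y₅ = fun t x y => 2 * Dy (Dx u) t x y * Dt p t x y - Dt (Dy u) t x y * Dx p t x y
      - Dy u t x y * Dt (Dx p) t x y - Dt (Dx u) t x y * Dy p t x y
      + Dx u t x y * Dt (Dy p) t x y - Dt (Dt p) t x y)
    (hF : Fp = fun t x y => Dy (Dy p) t x y - Dy u t x y * Dx (Dx p) t x y
      + Dy (Dx u) t x y * Dx p t x y + Dx u t x y * Dy (Dx p) t x y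
      - Dx (Dx u) t x y * Dy p t x y - Dt (Dx p) t x y) :
    ∀ t x y : ℝ, Dx Y₅ t x y - Dy X₅ t x y = Dt Fp t x y := by
  intro t x y
  have hYx := HasDerivAt.deriv <|
      (((((((hu.Dx.Dy.hasDerivAt_Dx t x y).const_mul 2).fun_mul (hp.Dt.hasDerivAt_Dx t x y)).fun_sub
      ((hu.Dy.Dt.hasDerivAt_Dx t x y).fun_mul (hp.Dx.hasDerivAt_Dx t x y))).fun_sub
      ((hu.Dy.hasDerivAt_Dx t x y).fun_mul (hp.Dx.Dt.hasDerivAt_Dx t x y))).fun_sub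
      ((hu.Dx.Dt.hasDerivAt_Dx t x y).fun_mul (hp.Dy.hasDerivAt_Dx t x y))).fun_add
      ((hu.Dx.hasDerivAt_Dx t x y).fun_mul (hp.Dy.Dt.hasDerivAt_Dx t x y))).fun_sub
      (hp.Dt.Dt.hasDerivAt_Dx t x y)
  have hXy := HasDerivAt.deriv <|
      ((((hu.Dx.Dx.hasDerivAt_Dy t x y).const_mul 2).fun_mul (hp.Dt.hasDerivAt_Dy t x y)).fun_sub
      (((hu.Dx.Dt.hasDerivAt_Dy t x y).const_mul 2).fun_mul (hp.Dx.hasDerivAt_Dy t x y))).fun_sub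
      (hp.Dy.Dt.hasDerivAt_Dy t x y)
  have hFt := HasDerivAt.deriv <|
      (((((hp.Dy.Dy.hasDerivAt_Dt t x y).fun_sub
      ((hu.Dy.hasDerivAt_Dt t x y).fun_mul (hp.Dx.Dx.hasDerivAt_Dt t x y))).fun_add
      ((hu.Dx.Dy.hasDerivAt_Dt t x y).fun_mul (hp.Dx.hasDerivAt_Dt t x y))).fun_add
      ((hu.Dx.hasDerivAt_Dt t x y).fun_mul (hp.Dx.Dy.hasDerivAt_Dt t x y))).fun_sub
      ((hu.Dx.Dx.hasDerivAt_Dt t x y).fun_mul (hp.Dy.hasDerivAt_Dt t x y))).fun_sub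
      (hp.Dx.Dt.hasDerivAt_Dt t x y)
  subst hX hY hF
  refine (congrArg₂ (· - ·) hYx hXy).trans (Eq.trans ?_ hFt.symm)
  simp only [hu.Dy_Dx_comm, hu.Dx.Dx_Dt_comm, hu.Dx.Dy_Dt_comm,
    hu.Dx.Dy_Dx_comm, hu.Dy.Dx_Dt_comm, hp.Dx_Dt_comm, hp.Dy_Dt_comm, hp.Dy_Dx_comm,
    hp.Dx.Dx_Dt_comm, hp.Dy.Dx_Dt_comm, hp.Dy.Dy_Dt_comm, hp.Dt.Dx_Dt_comm]
  ring
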